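/- Let R₁ be an IF ring with infinite weak global dimension and let R₂ be a ring that is not (left and right) coherent with finite weak global dimension. Then the direct product R₁ × R₂ is a GF-closed ring with finite left and right weak Gorenstein global dimensions, but R₁ × R₂ is neither (left and right) coherent nor of finite weak global dimension. -/

import Mathlib

/-!
Background definitions for D. Bennis, "Weak Gorenstein global dimensions".

Conventions.  All rings are associative with identity.  A *left* `R`-module is a type with
`[AddCommGroup M] [Module R M]`; a *right* `R`-module is a left module over the opposite ring,
i.e. `[Module Rᵐᵒᵖ M]`.  All "right-handed" notions below are obtained by applying the
corresponding "left-handed" notion to the opposite ring `Rᵐᵒᵖ`.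
-/

open MulOpposite

universe u

section Tensor

variable (S : Type u) [Ring S]

/-- The subgroup of relations defining the tensor product `A ⊗_S M` of a right `S`-module `A`
and a left `S`-module `M` over a (possibly noncommutative) ring `S`. -/
def tensorRels (A : Type u) [AddCommGroup A] [Module Sᵐᵒᵖ A]
    (M : Type u) [AddCommGroup M] [Module S M] :
    AddSubgroup (FreeAbelianGroup (A × M)) :=
  AddSubgroup.closure
    { x | (∃ a₁ a₂ m, x = FreeAbelianGroup.of (a₁ + a₂, m) - FreeAbelianGroup.of (a₁, m) -
            FreeAbelianGroup.of (a₂, m)) ∨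
          (∃ a m₁ m₂, x = FreeAbelianGroup.of (a, m₁ + m₂) - FreeAbelianGroup.of (a, m₁) -
            FreeAbelianGroup.of (a, m₂)) ∨
          (∃ (a : A) (r : S) (m : M), x = FreeAbelianGroup.of (op r • a, m) - FreeAbelianGroup.of (a, r • m)) }

/-- The tensor product `A ⊗_S M` (an abelian group) of a right `S`-module `A` and a left
`S`-module `M` over a (possibly noncommutative) ring `S`. -/
def NTensor (A : Type u) [AddCommGroup A] [Module Sᵐᵒᵖ A]
    (M : Type u) [AddCommGroup M] [Module S M] : Type u :=
  FreeAbelianGroup (A × M) ⧸ tensorRels S A M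

instance (A : Type u) [AddCommGroup A] [Module Sᵐᵒᵖ A]
    (M : Type u) [AddCommGroup M] [Module S M] : AddCommGroup (NTensor S A M) :=
  QuotientAddGroup.Quotient.addCommGroup _

namespace NTensor

variable {S}
variable {A A' : Type u} [AddCommGroup A] [Module Sᵐᵒᵖ A] [AddCommGroup A'] [Module Sᵐᵒᵖ A']
variable {M M' : Type u} [AddCommGroup M] [Module S M] [AddCommGroup M'] [Module S M']

/-- Functoriality of `A ⊗_S −` : the map `A ⊗_S M → A ⊗_S M'` induced by a linear map
`g : M → M'` of left `S`-modules. -/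
def rmap (A : Type u) [AddCommGroup A] [Module Sᵐᵒᵖ A] (g : M →ₗ[S] M') :
    NTensor S A M →+ NTensor S A M' :=
  QuotientAddGroup.map (tensorRels S A M) (tensorRels S A M') (FreeAbelianGroup.map (Prod.map id g)) (by
    simp only [tensorRels]
    refine (AddSubgroup.closure_le _).2 ?_
    rintro x (⟨a₁, a₂, m, rfl⟩ | ⟨a, m₁, m₂, rfl⟩ | ⟨a, r, m, rfl⟩) <;>
      refine SetLike.mem_coe.2 (AddSubgroup.mem_comap.2 (AddSubgroup.subset_closure ?_)) <;>
      simp only [map_sub, map_add, map_smul, FreeAbelianGroup.map_of_apply, Prod.map_apply,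
        id_eq, Set.mem_setOf_eq]
    · exact Or.inl ⟨a₁, a₂, g m, rfl⟩
    · exact Or.inr (Or.inl ⟨a, g m₁, g m₂, rfl⟩)
    · exact Or.inr (Or.inr ⟨a, r, g m, rfl⟩))

/-- Functoriality of `− ⊗_S M` : the map `A ⊗_S M → A' ⊗_S M` induced by a linear map
`f : A → A'` of right `S`-modules. -/
def lmap (M : Type u) [AddCommGroup M] [Module S M] (f : A →ₗ[Sᵐᵒᵖ] A') :
    NTensor S A M →+ NTensor S A' M :=
  QuotientAddGroup.map (tensorRels S A M) (tensorRels S A' M) (FreeAbelianGroup.map (Prod.map f id)) (by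
    simp only [tensorRels]
    refine (AddSubgroup.closure_le _).2 ?_
    rintro x (⟨a₁, a₂, m, rfl⟩ | ⟨a, m₁, m₂, rfl⟩ | ⟨a, r, m, rfl⟩) <;>
      refine SetLike.mem_coe.2 (AddSubgroup.mem_comap.2 (AddSubgroup.subset_closure ?_)) <;>
      simp only [map_sub, map_add, map_smul, FreeAbelianGroup.map_of_apply, Prod.map_apply,
        id_eq, Set.mem_setOf_eq]
    · exact Or.inl ⟨f a₁, f a₂, m, rfl⟩
    · exact Or.inr (Or.inl ⟨f a, m₁, m₂, rfl⟩)
    · exact Or.inr (Or.inr ⟨f a, r, m, rfl⟩))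

end NTensor

end Tensor

section Dims

variable (S : Type u) [Ring S]

/-- A left `S`-module `M` is *flat* if tensoring with it preserves injectivity of maps of
right `S`-modules. -/
def IsFlatMod (M : ModuleCat.{u} S) : Prop :=
  ∀ (A B : Type u) [AddCommGroup A] [Module Sᵐᵒᵖ A] [AddCommGroup B] [Module Sᵐᵒᵖ B]
    (f : A →ₗ[Sᵐᵒᵖ] B), Function.Injective f →
      Function.Injective (NTensor.lmap (↥M) f)

/-- A left `S`-module `M` is *Gorenstein flat* if there is an exact sequence
`⋯ → F (-1) → F 0 → F 1 → ⋯` of flat left `S`-modules with `M ≅ Im (F 0 → F 1)` which stays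
exact after applying `I ⊗_S −` for every injective right `S`-module `I`
(a *complete flat resolution*). -/
def IsGorensteinFlat (M : ModuleCat.{u} S) : Prop :=
  ∃ (F : ℤ → ModuleCat.{u} S) (d : ∀ n : ℤ, ↥(F n) →ₗ[S] ↥(F (n + 1))),
    (∀ n, IsFlatMod S (F n)) ∧
    (∀ n, Function.Exact (d n) (d (n + 1))) ∧
    Nonempty (↥M ≃ₗ[S] ↥(LinearMap.range (d 0))) ∧
    (∀ (I : Type u) [AddCommGroup I] [Module Sᵐᵒᵖ I], Module.Injective Sᵐᵒᵖ I →
      ∀ n, Function.Exact (NTensor.rmap I (d n)) (NTensor.rmap I (d (n + 1))))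

/-- `gflatDimLE S n M` means `Gfd_S(M) ≤ n`: there is an exact sequence
`0 → G_n → ⋯ → G_0 → M → 0` of left `S`-modules with all `G_i` Gorenstein flat. -/
def gflatDimLE : ℕ → ModuleCat.{u} S → Prop
  | 0, M => IsGorensteinFlat S M
  | n + 1, M => ∃ (K G : ModuleCat.{u} S) (ι : ↥K →ₗ[S] ↥G) (π : ↥G →ₗ[S] ↥M),
      Function.Injective ι ∧ Function.Surjective π ∧ Function.Exact ι π ∧
      IsGorensteinFlat S G ∧ gflatDimLE n K

/-- `flatDimLE S n M` means `fd_S(M) ≤ n`: there is an exact sequence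
`0 → F_n → ⋯ → F_0 → M → 0` of left `S`-modules with all `F_i` flat. -/
def flatDimLE : ℕ → ModuleCat.{u} S → Prop
  | 0, M => IsFlatMod S M
  | n + 1, M => ∃ (K F : ModuleCat.{u} S) (ι : ↥K →ₗ[S] ↥F) (π : ↥F →ₗ[S] ↥M),
      Function.Injective ι ∧ Function.Surjective π ∧ Function.Exact ι π ∧
      IsFlatMod S F ∧ flatDimLE n K

/-- `injDimLE S n M` means `id_S(M) ≤ n`: there is an exact sequence
`0 → M → I^0 → ⋯ → I^n → 0` of left `S`-modules with all `I^i` injective. -/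
def injDimLE : ℕ → ModuleCat.{u} S → Prop
  | 0, M => Module.Injective S ↥M
  | n + 1, M => ∃ (I C : ModuleCat.{u} S) (ι : ↥M →ₗ[S] ↥I) (π : ↥I →ₗ[S] ↥C),
      Function.Injective ι ∧ Function.Surjective π ∧ Function.Exact ι π ∧
      Module.Injective S ↥I ∧ injDimLE n C

/-- The Gorenstein flat dimension `Gfd_S(M) ∈ ℕ∞` of a left `S`-module `M`. -/
noncomputable def gflatDim (M : ModuleCat.{u} S) : ℕ∞ :=
  sInf {d : ℕ∞ | ∃ n : ℕ, d = n ∧ gflatDimLE S n M}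

/-- The flat dimension `fd_S(M) ∈ ℕ∞` of a left `S`-module `M`. -/
noncomputable def flatDim (M : ModuleCat.{u} S) : ℕ∞ :=
  sInf {d : ℕ∞ | ∃ n : ℕ, d = n ∧ flatDimLE S n M}

/-- The injective dimension `id_S(M) ∈ ℕ∞` of a left `S`-module `M`. -/
noncomputable def injDim (M : ModuleCat.{u} S) : ℕ∞ :=
  sInf {d : ℕ∞ | ∃ n : ℕ, d = n ∧ injDimLE S n M}

/-- The left weak Gorenstein global dimension
`l.Gwdim(S) = sup { Gfd_S(M) | M a left S-module }`.  The right weak Gorenstein global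
dimension of `S` is `gorensteinWeakGlobalDim Sᵐᵒᵖ`. -/
noncomputable def gorensteinWeakGlobalDim : ℕ∞ :=
  ⨆ M : ModuleCat.{u} S, gflatDim S M

/-- The left weak global dimension `sup { fd_S(M) | M a left S-module }`.  (By a classical
theorem it agrees with `weakGlobalDim Sᵐᵒᵖ`, and the common value is `wdim S`.) -/
noncomputable def weakGlobalDim : ℕ∞ :=
  ⨆ M : ModuleCat.{u} S, flatDim S M

/-- The left finitistic flat dimension
`l.FFD(S) = sup { fd_S(M) | M a left S-module with fd_S(M) < ∞ }`. -/
noncomputable def finitisticFlatDim : ℕ∞ :=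
  sSup {d : ℕ∞ | d ≠ ⊤ ∧ ∃ M : ModuleCat.{u} S, flatDim S M = d}

/-- The left finitistic Gorenstein flat dimension
`l.FGFD(S) = sup { Gfd_S(M) | M a left S-module with Gfd_S(M) < ∞ }`. -/
noncomputable def finitisticGFlatDim : ℕ∞ :=
  sSup {d : ℕ∞ | d ≠ ⊤ ∧ ∃ M : ModuleCat.{u} S, gflatDim S M = d}

/-- A ring `S` is *left GF-closed* if the class of Gorenstein flat left `S`-modules is closed
under extensions.  `S` is right GF-closed iff `Sᵐᵒᵖ` is left GF-closed, and GF-closed if both. -/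
def IsGFClosed : Prop :=
  ∀ (A B C : ModuleCat.{u} S) (f : ↥A →ₗ[S] ↥B) (g : ↥B →ₗ[S] ↥C),
    Function.Injective f → Function.Surjective g → Function.Exact f g →
      IsGorensteinFlat S A → IsGorensteinFlat S C → IsGorensteinFlat S B

/-- A ring `S` is *left coherent* if every finitely generated left ideal of `S` is finitely
presented (as a left `S`-module).  `S` is right coherent iff `Sᵐᵒᵖ` is left coherent. -/
def IsLeftCoherent : Prop :=
  ∀ I : Submodule S S, I.FG → Module.FinitePresentation S ↥I

/-- A ring `S` is *left IF* if every injective left `S`-module is flat.  `S` is right IF iff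
`Sᵐᵒᵖ` is left IF, and IF if both. -/
def IsLeftIF : Prop :=
  ∀ E : ModuleCat.{u} S, Module.Injective S ↥E → IsFlatMod S E

/-- A ring `S` is *left `n`-IF* if `fd_S(E) ≤ n` for every injective left `S`-module `E`.
`S` is right `n`-IF iff `Sᵐᵒᵖ` is left `n`-IF, and `n`-IF if both. -/
def IsLeftNIF (n : ℕ) : Prop :=
  ∀ E : ModuleCat.{u} S, Module.Injective S ↥E → flatDim S E ≤ (n : ℕ∞)

/-- `Ext¹_S(T, K) = 0`, expressed by its standard characterization: every extension of `T`
by `K` (i.e. every short exact sequence `0 → K → X → T → 0`) splits. -/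
def Ext1Zero (T K : ModuleCat.{u} S) : Prop :=
  ∀ (X : ModuleCat.{u} S) (ι : ↥K →ₗ[S] ↥X) (π : ↥X →ₗ[S] ↥T),
    Function.Injective ι → Function.Surjective π → Function.Exact ι π →
      ∃ ρ : ↥X →ₗ[S] ↥K, ρ.comp ι = LinearMap.id

/-- A left `S`-module `K` is *cotorsion* if `Ext¹_S(F, K) = 0` for every flat left
`S`-module `F`. -/
def IsCotorsion (K : ModuleCat.{u} S) : Prop :=
  ∀ F : ModuleCat.{u} S, IsFlatMod S F → Ext1Zero S F K

/-- `Tor₁^S(A, T) = 0` for a right `S`-module `A` and a left `S`-module `T`, expressed by its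
standard characterization: for every short exact sequence `0 → K → F → T → 0` of left
`S`-modules with `F` flat, the induced map `A ⊗_S K → A ⊗_S F` is injective. -/
def Tor1Zero (A : Type u) [AddCommGroup A] [Module Sᵐᵒᵖ A] (T : ModuleCat.{u} S) : Prop :=
  ∀ (K F : ModuleCat.{u} S) (ι : ↥K →ₗ[S] ↥F) (π : ↥F →ₗ[S] ↥T),
    IsFlatMod S F → Function.Injective ι → Function.Surjective π → Function.Exact ι π →
      Function.Injective (NTensor.rmap A ι)

/-- A left `S`-module is *finitely presented* if it admits a presentation with finitely many
generators and relations. -/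
abbrev IsFinitelyPresented (M : ModuleCat.{u} S) : Prop :=
  Module.FinitePresentation S ↥M

end Dims

/-! ### Character modules over a noncommutative ring -/

/-- The character group `Hom_ℤ(M, ℚ/ℤ)`, viewed as a right module when `M` is a left module. -/
def CharDual (M : Type u) [AddCommGroup M] : Type u := M →+ AddCircle (1 : ℚ)

namespace CharDual

section Group

variable {M : Type u} [AddCommGroup M]

instance : AddCommGroup (CharDual M) := inferInstanceAs (AddCommGroup (M →+ AddCircle (1 : ℚ)))

instance : FunLike (CharDual M) M (AddCircle (1 : ℚ)) :=
  inferInstanceAs (FunLike (M →+ AddCircle (1 : ℚ)) M (AddCircle (1 : ℚ)))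

instance : AddMonoidHomClass (CharDual M) M (AddCircle (1 : ℚ)) :=
  inferInstanceAs (AddMonoidHomClass (M →+ AddCircle (1 : ℚ)) M (AddCircle (1 : ℚ)))

@[ext] theorem ext {χ ψ : CharDual M} (h : ∀ m, χ m = ψ m) : χ = ψ := DFunLike.ext _ _ h

@[simp] theorem add_apply (χ ψ : CharDual M) (m : M) : (χ + ψ) m = χ m + ψ m := rfl

@[simp] theorem zero_apply (m : M) : (0 : CharDual M) m = 0 := rfl

/-- A character given by an additive map. -/
def ofHom (χ : M →+ AddCircle (1 : ℚ)) : CharDual M := χ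

@[simp] theorem ofHom_apply (χ : M →+ AddCircle (1 : ℚ)) (m : M) : ofHom χ m = χ m := rfl

theorem exists_extension {N : Type u} [AddCommGroup N] (f : M →+ N) (hf : Function.Injective f)
    (χ : M →+ AddCircle (1 : ℚ)) : ∃ ψ : N →+ AddCircle (1 : ℚ), ψ.comp f = χ :=
  (Module.Baer.of_divisible _).extension_property_addMonoidHom f hf χ

theorem eq_zero_of_forall {m : M} (h : ∀ χ : M →+ AddCircle (1 : ℚ), χ m = 0) : m = 0 :=
  CharacterModule.eq_zero_of_character_apply h

/-- Characters detect membership in a subgroup. -/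
theorem mem_of_forall (H : AddSubgroup M) {m : M}
    (h : ∀ χ : M →+ AddCircle (1 : ℚ), (∀ x ∈ H, χ x = 0) → χ m = 0) : m ∈ H := by
  rw [← QuotientAddGroup.eq_zero_iff]
  refine eq_zero_of_forall fun χ => h (χ.comp (QuotientAddGroup.mk' H)) fun x hx => ?_
  rw [AddMonoidHom.comp_apply, QuotientAddGroup.mk'_apply, (QuotientAddGroup.eq_zero_iff x).2 hx,
    map_zero]

end Group

section Module

variable {S : Type u} [Ring S] {M N P : Type u} [AddCommGroup M] [Module S M]
  [AddCommGroup N] [Module S N] [AddCommGroup P] [Module S P]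

instance : Module Sᵐᵒᵖ (CharDual M) where
  smul s χ := AddMonoidHom.comp χ (DistribSMul.toAddMonoidHom M s.unop)
  one_smul χ := ext fun m => congrArg χ (one_smul S m)
  mul_smul s t χ := ext fun m => congrArg χ (mul_smul t.unop s.unop m)
  smul_zero _ := rfl
  smul_add _ _ _ := rfl
  add_smul s t χ := ext fun m =>
    (congrArg χ (add_smul s.unop t.unop m)).trans (map_add χ _ _)
  zero_smul χ := ext fun m => (congrArg χ (zero_smul S m)).trans (map_zero χ)

theorem smul_apply (s : Sᵐᵒᵖ) (χ : CharDual M) (m : M) : (s • χ) m = χ (s.unop • m) := rfl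

/-- Precomposition with a linear map. -/
def map (f : M →ₗ[S] N) : CharDual N →ₗ[Sᵐᵒᵖ] CharDual M where
  toFun χ := AddMonoidHom.comp χ f.toAddMonoidHom
  map_add' _ _ := rfl
  map_smul' s χ := ext fun m => congrArg χ (f.map_smul s.unop m).symm

@[simp] theorem map_apply (f : M →ₗ[S] N) (χ : CharDual N) (m : M) : map f χ m = χ (f m) := rfl

theorem map_injective {f : M →ₗ[S] N} (hf : Function.Surjective f) :
    Function.Injective (map f) := fun χ ψ h => ext fun n => by
  obtain ⟨m, rfl⟩ := hf n
  exact DFunLike.congr_fun h m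

theorem map_surjective {f : M →ₗ[S] N} (hf : Function.Injective f) :
    Function.Surjective (map f) := fun χ => by
  obtain ⟨ψ, hψ⟩ := exists_extension f.toAddMonoidHom hf χ
  exact ⟨ψ, hψ⟩

theorem map_exact {f : M →ₗ[S] N} {g : N →ₗ[S] P} (hg : Function.Surjective g)
    (h : Function.Exact f g) : Function.Exact (map g) (map f) := fun χ => by
  constructor
  · intro hχ
    have hker : ∀ n ∈ g.toAddMonoidHom.ker, χ n = 0 := fun n hn => by
      obtain ⟨m, rfl⟩ := (h n).1 hn
      exact DFunLike.congr_fun hχ m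
    refine ⟨g.toAddMonoidHom.liftOfSurjective hg ⟨χ, hker⟩, ext fun n => ?_⟩
    exact AddMonoidHom.liftOfRightInverse_comp_apply _ _ (Function.rightInverse_surjInv hg)
      ⟨χ, hker⟩ n
  · rintro ⟨ψ, rfl⟩
    exact ext fun m => by simp [h.apply_apply_eq_zero]

/-- Isomorphic modules have isomorphic character modules. -/
def congr (e : M ≃ₗ[S] N) : CharDual M ≃ₗ[Sᵐᵒᵖ] CharDual N :=
  LinearEquiv.ofLinearMap (map e.symm.toLinearMap) (map e.toLinearMap)
    (LinearMap.ext fun χ => ext fun n => by simp)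
    (LinearMap.ext fun χ => ext fun n => by simp)

end Module

end CharDual

namespace NTensor

variable {S : Type u} [Ring S] {A B : Type u} [AddCommGroup A] [Module Sᵐᵒᵖ A] [AddCommGroup B]
  [Module Sᵐᵒᵖ B] {M N P : Type u} [AddCommGroup M] [Module S M] [AddCommGroup N] [Module S N]
  [AddCommGroup P] [Module S P]

/-- The quotient map defining the tensor product. -/
def mk : FreeAbelianGroup (A × M) →+ NTensor S A M := QuotientAddGroup.mk' (tensorRels S A M)

theorem mk_eq_zero {x : FreeAbelianGroup (A × M)} (hx : x ∈ tensorRels S A M) :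
    (mk x : NTensor S A M) = 0 := (QuotientAddGroup.eq_zero_iff x).2 hx

/-- The pure tensor `a ⊗ m`. -/
def tmul (a : A) (m : M) : NTensor S A M := mk (FreeAbelianGroup.of (a, m))

theorem add_tmul (a b : A) (m : M) : (tmul (a + b) m : NTensor S A M) = tmul a m + tmul b m := by
  simp only [tmul]
  rw [← sub_eq_zero, ← map_add, ← map_sub, ← sub_sub]
  exact mk_eq_zero (AddSubgroup.subset_closure (Or.inl ⟨a, b, m, rfl⟩))

theorem tmul_add (a : A) (m n : M) : (tmul a (m + n) : NTensor S A M) = tmul a m + tmul a n := by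
  simp only [tmul]
  rw [← sub_eq_zero, ← map_add, ← map_sub, ← sub_sub]
  exact mk_eq_zero
    (AddSubgroup.subset_closure (Or.inr (Or.inl ⟨a, m, n, rfl⟩)))

theorem smul_tmul (a : A) (r : S) (m : M) :
    (tmul (op r • a) m : NTensor S A M) = tmul a (r • m) := by
  simp only [tmul]
  rw [← sub_eq_zero, ← map_sub]
  exact mk_eq_zero
    (AddSubgroup.subset_closure (Or.inr (Or.inr ⟨a, r, m, rfl⟩)))

@[simp] theorem lmap_tmul (f : A →ₗ[Sᵐᵒᵖ] B) (a : A) (m : M) :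
    lmap M f (tmul a m) = tmul (f a) m := by
  change mk (FreeAbelianGroup.map _ _) = _
  rw [FreeAbelianGroup.map_of_apply]; rfl

@[simp] theorem rmap_tmul (f : M →ₗ[S] N) (a : A) (m : M) :
    rmap A f (tmul a m) = tmul a (f m) := by
  change mk (FreeAbelianGroup.map _ _) = _
  rw [FreeAbelianGroup.map_of_apply]; rfl

theorem hom_ext {D : Type*} [AddCommGroup D] {f g : NTensor S A M →+ D}
    (h : ∀ a m, f (tmul a m) = g (tmul a m)) : f = g := by
  refine QuotientAddGroup.addMonoidHom_ext _ (FreeAbelianGroup.lift_ext _ _ ?_)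
  rintro ⟨a, m⟩
  exact h a m

/-- The character of `A ⊗ M` attached to a linear map `A → M⁺`. -/
def uncurry (h : A →ₗ[Sᵐᵒᵖ] CharDual M) : NTensor S A M →+ AddCircle (1 : ℚ) :=
  QuotientAddGroup.lift (tensorRels S A M) (FreeAbelianGroup.lift fun x => h x.1 x.2) (by
    refine (AddSubgroup.closure_le _).2 ?_
    rintro x (⟨a₁, a₂, m, rfl⟩ | ⟨a, m₁, m₂, rfl⟩ | ⟨a, r, m, rfl⟩) <;>
      simp [CharDual.smul_apply])

@[simp] theorem uncurry_tmul (h : A →ₗ[Sᵐᵒᵖ] CharDual M) (a : A) (m : M) :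
    uncurry h (tmul a m) = h a m := by
  change FreeAbelianGroup.lift (fun x : A × M => h x.1 x.2) (FreeAbelianGroup.of (a, m)) = _
  rw [FreeAbelianGroup.lift_apply_of]

/-- The linear map `A → M⁺` attached to a character of `A ⊗ M`. -/
def curry (χ : NTensor S A M →+ AddCircle (1 : ℚ)) : A →ₗ[Sᵐᵒᵖ] CharDual M where
  toFun a := CharDual.ofHom (AddMonoidHom.mk' (fun m => χ (tmul a m)) fun m n => by
    rw [tmul_add, map_add])
  map_add' a b := CharDual.ext fun m => by
    change χ (tmul (a + b) m) = χ (tmul a m) + χ (tmul b m)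
    rw [add_tmul, map_add]
  map_smul' r a := CharDual.ext fun m => congrArg χ (smul_tmul a r.unop m)

@[simp] theorem curry_apply (χ : NTensor S A M →+ AddCircle (1 : ℚ)) (a : A) (m : M) :
    curry χ a m = χ (tmul a m) := rfl

theorem lmap_injective_iff (f : A →ₗ[Sᵐᵒᵖ] B) :
    Function.Injective (lmap M f) ↔
      ∀ g : A →ₗ[Sᵐᵒᵖ] CharDual M, ∃ h : B →ₗ[Sᵐᵒᵖ] CharDual M, ∀ a, h (f a) = g a := by
  constructor
  · intro hf g
    obtain ⟨ψ, hψ⟩ := CharDual.exists_extension _ hf (uncurry g)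
    refine ⟨curry ψ, fun a => CharDual.ext fun m => ?_⟩
    simpa using DFunLike.congr_fun hψ (tmul a m)
  · intro hf
    refine (injective_iff_map_eq_zero _).2 fun x hx => CharDual.eq_zero_of_forall fun χ => ?_
    obtain ⟨h, hh⟩ := hf (curry χ)
    have : χ = (uncurry h).comp (lmap M f) := hom_ext fun a m => by simp [hh]
    rw [this, AddMonoidHom.comp_apply, hx, map_zero]

theorem rmap_injective (f : M →ₗ[S] N)
    (hf : ∀ g : A →ₗ[Sᵐᵒᵖ] CharDual M, ∃ h : A →ₗ[Sᵐᵒᵖ] CharDual N,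
      ∀ a m, h a (f m) = g a m) :
    Function.Injective (rmap A f) := by
  refine (injective_iff_map_eq_zero _).2 fun x hx => CharDual.eq_zero_of_forall fun χ => ?_
  obtain ⟨h, hh⟩ := hf (curry χ)
  have : χ = (uncurry h).comp (rmap A f) := hom_ext fun a m => by simp [hh]
  rw [this, AddMonoidHom.comp_apply, hx, map_zero]

theorem rmap_comp (g : N →ₗ[S] P) (f : M →ₗ[S] N) :
    rmap A (g.comp f) = (rmap A g).comp (rmap A f) := hom_ext fun a m => by simp

theorem rmap_surjective {f : M →ₗ[S] N} (hf : Function.Surjective f) :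
    Function.Surjective (rmap A f) := by
  rw [← AddMonoidHom.range_eq_top, eq_top_iff]
  intro x _
  refine CharDual.mem_of_forall _ fun χ hχ => ?_
  have : χ = 0 := hom_ext fun a n => by
    obtain ⟨m, rfl⟩ := hf n
    exact hχ _ ⟨tmul a m, by simp⟩
  rw [this, AddMonoidHom.zero_apply]

theorem rmap_exact {f : M →ₗ[S] N} {g : N →ₗ[S] P} (hg : Function.Surjective g)
    (h : Function.Exact f g) : Function.Exact (rmap A f) (rmap A g) := fun x => by
  constructor
  · intro hx
    refine CharDual.mem_of_forall (rmap A f).range fun χ hχ => ?_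
    have hker : ∀ a, CharDual.map f (curry χ a) = 0 := fun a => CharDual.ext fun m => by
      simpa using hχ _ ⟨tmul a m, rfl⟩
    have hmem : ∀ a, curry χ a ∈ LinearMap.range (CharDual.map g) := fun a =>
      (CharDual.map_exact hg h _).1 (hker a)
    let e := LinearEquiv.ofInjective (CharDual.map g) (CharDual.map_injective hg)
    let k : A →ₗ[Sᵐᵒᵖ] CharDual P := e.symm.toLinearMap.comp ((curry χ).codRestrict _ hmem)
    have hk : ∀ a, CharDual.map g (k a) = curry χ a := fun a =>
      congrArg Subtype.val (e.apply_symm_apply ⟨curry χ a, hmem a⟩)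
    have : χ = (uncurry k).comp (rmap A g) := hom_ext fun a n => by
      have := DFunLike.congr_fun (hk a) n
      simpa using this.symm
    rw [this, AddMonoidHom.comp_apply, hx, map_zero]
  · rintro ⟨y, rfl⟩
    rw [← AddMonoidHom.comp_apply, ← rmap_comp, h.linearMap_comp_eq_zero]
    have : rmap A (0 : M →ₗ[S] P) = 0 := hom_ext fun a m => by
      rw [rmap_tmul, LinearMap.zero_apply, AddMonoidHom.zero_apply]
      have := tmul_add (S := S) a (0 : P) 0
      simpa using this
    rw [this, AddMonoidHom.zero_apply]

end NTensor

/-- Lambek's criterion: a module is flat iff its character module is injective. -/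
theorem isFlatMod_iff_injective_charDual {S : Type u} [Ring S] (M : ModuleCat.{u} S) :
    IsFlatMod S M ↔ Module.Injective Sᵐᵒᵖ (CharDual M) := by
  constructor
  · intro h
    exact ⟨fun A B _ _ _ _ f hf g => (NTensor.lmap_injective_iff f).1 (h A B f hf) g⟩
  · intro h A B _ _ _ _ f hf
    exact (NTensor.lmap_injective_iff f).2 fun g => h.out f hf g

/-! ### Flat modules -/

section Flat

open CategoryTheory

variable {S : Type u} [Ring S] {M N P : Type u} [AddCommGroup M] [Module S M]
  [AddCommGroup N] [Module S N] [AddCommGroup P] [Module S P]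

/-- The character module of `M` has injective dimension `< n`; equivalently, `M` has flat
dimension `< n`. -/
def FlatDimLT (S : Type u) [Ring S] (n : ℕ) (M : Type u) [AddCommGroup M] [Module S M] : Prop :=
  HasInjectiveDimensionLT (ModuleCat.of Sᵐᵒᵖ (CharDual M)) n

theorem flatDimLT_one_iff : FlatDimLT S 1 M ↔ IsFlatMod S (ModuleCat.of S M) := by
  rw [isFlatMod_iff_injective_charDual, Module.injective_iff_injective_object,
    injective_iff_hasInjectiveDimensionLT_one]
  rfl

theorem FlatDimLT.mono {m n : ℕ} (hmn : m ≤ n) (h : FlatDimLT S m M) : FlatDimLT S n M :=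
  have : HasInjectiveDimensionLT (ModuleCat.of Sᵐᵒᵖ (CharDual M)) m := h
  hasInjectiveDimensionLT_of_ge _ m n hmn

variable {f : M →ₗ[S] N} {g : N →ₗ[S] P}

theorem CharDual.map_comp_map_eq_zero (h : Function.Exact f g) :
    (CharDual.map f).comp (CharDual.map g) = 0 :=
  LinearMap.ext fun χ => CharDual.ext fun m => by simp [h.apply_apply_eq_zero]

theorem CharDual.shortExact (hf : Function.Injective f) (hg : Function.Surjective g)
    (h : Function.Exact f g) :
    (ShortComplex.mk (ModuleCat.ofHom (CharDual.map g)) (ModuleCat.ofHom (CharDual.map f))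
      (ModuleCat.hom_ext (CharDual.map_comp_map_eq_zero h))).ShortExact where
  exact := (ShortComplex.ShortExact.moduleCat_exact_iff_function_exact _).2
    (CharDual.map_exact hg h)
  mono_f := (ModuleCat.mono_iff_injective _).2 (CharDual.map_injective hg)
  epi_g := (ModuleCat.epi_iff_surjective _).2 (CharDual.map_surjective hf)

theorem FlatDimLT.middle {n : ℕ} (hf : Function.Injective f) (hg : Function.Surjective g)
    (h : Function.Exact f g) (hM : FlatDimLT S n M) (hP : FlatDimLT S n P) : FlatDimLT S n N :=
  (CharDual.shortExact hf hg h).hasInjectiveDimensionLT_X₂ n hP hM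

theorem FlatDimLT.kernel {n : ℕ} (hf : Function.Injective f) (hg : Function.Surjective g)
    (h : Function.Exact f g) (hN : FlatDimLT S n N) (hP : FlatDimLT S (n + 1) P) :
    FlatDimLT S n M :=
  (CharDual.shortExact hf hg h).hasInjectiveDimensionLT_X₃ n hN hP

theorem FlatDimLT.cokernel {n : ℕ} (hf : Function.Injective f) (hg : Function.Surjective g)
    (h : Function.Exact f g) (hM : FlatDimLT S n M) (hN : FlatDimLT S (n + 1) N) :
    FlatDimLT S (n + 1) P :=
  (CharDual.shortExact hf hg h).hasInjectiveDimensionLT_X₁ n hM hN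

theorem FlatDimLT.of_equiv {n : ℕ} (e : M ≃ₗ[S] N) (h : FlatDimLT S n M) : FlatDimLT S n N :=
  have : HasInjectiveDimensionLT (ModuleCat.of Sᵐᵒᵖ (CharDual M)) n := h
  hasInjectiveDimensionLT_of_iso (CharDual.congr e).toModuleIso n

theorem FlatDimLT.of_flatDimLE {n : ℕ} {M : ModuleCat.{u} S} (h : flatDimLE S n M) :
    FlatDimLT S (n + 1) M := by
  induction n generalizing M with
  | zero => exact flatDimLT_one_iff.2 h
  | succ n ih =>
    obtain ⟨K, F, ι, π, hι, hπ, hex, hF, hK⟩ := h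
    exact (ih hK).cokernel hι hπ hex ((flatDimLT_one_iff.2 hF).mono (by omega))

/-- A short exact sequence with flat cokernel stays exact under tensor products. -/
theorem exists_extension_of_flat (hf : Function.Injective f) (hg : Function.Surjective g)
    (h : Function.Exact f g) (hP : FlatDimLT S 1 P) {A : Type u} [AddCommGroup A] [Module Sᵐᵒᵖ A]
    (k : A →ₗ[Sᵐᵒᵖ] CharDual M) :
    ∃ l : A →ₗ[Sᵐᵒᵖ] CharDual N, ∀ a m, l a (f m) = k a m := by
  have hinj : Module.Injective Sᵐᵒᵖ (CharDual P) :=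
    (isFlatMod_iff_injective_charDual (ModuleCat.of S P)).1 (flatDimLT_one_iff.1 hP)
  obtain ⟨r, hr⟩ := hinj.out (CharDual.map g) (CharDual.map_injective hg) LinearMap.id
  obtain ⟨-, s, hs⟩ := ((CharDual.map_exact hg h).split_tfae'.out 1 0 rfl rfl).1
    ⟨CharDual.map_surjective hf, r, LinearMap.ext hr⟩
  exact ⟨s.comp k, fun a m => DFunLike.congr_fun (LinearMap.congr_fun hs (k a)) m⟩

theorem flatDimLT_one_of_subsingleton [Subsingleton M] : FlatDimLT S 1 M := by
  rw [flatDimLT_one_iff, isFlatMod_iff_injective_charDual]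
  have : Subsingleton (CharDual M) := ⟨fun χ ψ => CharDual.ext fun m => by
    rw [Subsingleton.elim m 0, map_zero, map_zero]⟩
  exact ⟨fun A B _ _ _ _ _ _ _ => ⟨0, fun _ => Subsingleton.elim (α := CharDual M) _ _⟩⟩

theorem flatDimLT_one_prod (hM : FlatDimLT S 1 M) (hN : FlatDimLT S 1 N) :
    FlatDimLT S 1 (M × N) :=
  hM.middle (f := LinearMap.inl S M N) (g := LinearMap.snd S M N) LinearMap.inl_injective
    LinearMap.snd_surjective .inl_snd hN

theorem flatDimLT_one_finsupp (ι : Type u) : FlatDimLT S 1 (ι →₀ S) := by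
  rw [flatDimLT_one_iff, isFlatMod_iff_injective_charDual]
  refine ⟨fun A B _ _ _ _ f hf g => ?_⟩
  choose k hk using fun i : ι => CharDual.exists_extension f.toAddMonoidHom hf
    (AddMonoidHom.mk' (fun a => g a (Finsupp.single i 1)) fun a b => by
      rw [map_add, CharDual.add_apply])
  let h (b : B) : (ι →₀ S) →+ AddCircle (1 : ℚ) :=
    Finsupp.liftAddHom fun i => AddMonoidHom.mk' (fun s => k i (op s • b)) fun s t => by
      rw [MulOpposite.op_add, add_smul, map_add]
  have hsingle (b : B) (i : ι) (s : S) : h b (Finsupp.single i s) = k i (op s • b) := by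
    simp [h]
  refine ⟨⟨⟨fun b => CharDual.ofHom (h b), fun b c => ?_⟩, fun s b => ?_⟩, fun a => ?_⟩
  · refine DFunLike.ext' (congrArg DFunLike.coe (Finsupp.addHom_ext (f := h (b + c))
      (g := h b + h c) fun i s => ?_))
    simp [hsingle]
  · refine DFunLike.ext' (congrArg DFunLike.coe (Finsupp.addHom_ext (f := h (s • b))
      (g := (h b).comp (DistribSMul.toAddMonoidHom (ι →₀ S) s.unop)) fun i t => ?_))
    rw [AddMonoidHom.comp_apply, DistribSMul.toAddMonoidHom_apply, Finsupp.smul_single,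
      smul_eq_mul, hsingle, hsingle, op_mul, op_unop, mul_smul]
  · refine DFunLike.ext' (congrArg DFunLike.coe (Finsupp.addHom_ext (f := h (f a))
      (g := (g a : (ι →₀ S) →+ AddCircle (1 : ℚ))) fun i t => ?_))
    rw [hsingle, ← map_smul]
    refine (DFunLike.congr_fun (hk i) (op t • a)).trans ?_
    change g (op t • a) (Finsupp.single i 1) = g a (Finsupp.single i t)
    rw [map_smul, CharDual.smul_apply, unop_op, Finsupp.smul_single, smul_eq_mul, mul_one]

end Flat

/-! ### Ring factors cut out by a central idempotent -/

/-- The data exhibiting a ring `T` as a direct factor of a ring `S`: a surjection `S → T` split by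
a (non-unital) inclusion whose value at `1` is a central idempotent. -/
structure Corner (S T : Type u) [Ring S] [Ring T] where
  /-- The projection onto the factor. -/
  proj : S →+* T
  /-- The inclusion of the factor. -/
  incl : T →ₙ+* S
  proj_incl : ∀ t, proj (incl t) = t
  incl_one_mul : ∀ s, incl 1 * s = incl (proj s)
  mul_incl_one : ∀ s, s * incl 1 = incl (proj s)

namespace Corner

variable {S T : Type u} [Ring S] [Ring T]

/-- The opposite of a factor is a factor of the opposite ring. -/
def op (c : Corner S T) : Corner Sᵐᵒᵖ Tᵐᵒᵖ where
  proj := RingHom.op c.proj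
  incl := NonUnitalRingHom.op c.incl
  proj_incl t := congrArg MulOpposite.op (c.proj_incl t.unop)
  incl_one_mul s := congrArg MulOpposite.op (c.mul_incl_one s.unop)
  mul_incl_one s := congrArg MulOpposite.op (c.incl_one_mul s.unop)

/-- A ring isomorphism exhibits its target as a factor of its source. -/
def ofRingEquiv (e : S ≃+* T) : Corner S T where
  proj := e
  incl := (e.symm : T →+* S)
  proj_incl t := e.apply_symm_apply t
  incl_one_mul s := by simp
  mul_incl_one s := by simp

/-- The first factor of a product ring. -/
def fst (S T : Type u) [Ring S] [Ring T] : Corner (S × T) S where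
  proj := RingHom.fst S T
  incl := ⟨⟨fun s => (s, 0), fun _ _ => by simp⟩, by simp, fun _ _ => by simp⟩
  proj_incl _ := rfl
  incl_one_mul s := show ((1 : S), (0 : T)) * s = (s.1, 0) by ext <;> simp
  mul_incl_one s := show s * ((1 : S), (0 : T)) = (s.1, 0) by ext <;> simp

/-- The second factor of a product ring. -/
def snd (S T : Type u) [Ring S] [Ring T] : Corner (S × T) T where
  proj := RingHom.snd S T
  incl := ⟨⟨fun t => (0, t), fun _ _ => by simp⟩, by simp, fun _ _ => by simp⟩
  proj_incl _ := rfl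
  incl_one_mul s := show ((0 : S), (1 : T)) * s = (0, s.2) by ext <;> simp
  mul_incl_one s := show s * ((0 : S), (1 : T)) = (0, s.2) by ext <;> simp

variable (c : Corner S T)

theorem incl_one_mul_incl (t : T) : c.incl 1 * c.incl t = c.incl t := by
  rw [← map_mul, one_mul]

section Component

variable (M : Type u) [AddCommGroup M] [Module S M]

/-- The component of an `S`-module over the factor `T`. -/
def Comp : Type u :=
  ((DistribSMul.toAddMonoidHom M (c.incl 1)).eqLocus (AddMonoidHom.id M) : AddSubgroup M)

instance : AddCommGroup (c.Comp M) := inferInstanceAs (AddCommGroup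
  ((DistribSMul.toAddMonoidHom M (c.incl 1)).eqLocus (AddMonoidHom.id M) : AddSubgroup M))

variable {M}

/-- The inclusion of the component. -/
def val : c.Comp M →+ M := AddSubgroup.subtype _

theorem val_injective : Function.Injective (c.val : c.Comp M → M) := Subtype.val_injective

theorem incl_one_smul_val (x : c.Comp M) : c.incl 1 • c.val x = c.val x := x.2

/-- The element of the component given by an element fixed by the central idempotent. -/
def mkComp (m : M) (hm : c.incl 1 • m = m) : c.Comp M := ⟨m, hm⟩

@[simp] theorem val_mkComp (m : M) (hm : c.incl 1 • m = m) : c.val (c.mkComp m hm) = m := rfl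

instance : SMul T (c.Comp M) where
  smul t x := c.mkComp (c.incl t • c.val x) (by rw [← mul_smul, incl_one_mul_incl])

@[simp] theorem val_smul (t : T) (x : c.Comp M) : c.val (t • x) = c.incl t • c.val x := rfl

instance : Module T (c.Comp M) where
  one_smul x := c.val_injective (c.incl_one_smul_val x)
  mul_smul s t x := c.val_injective (by simp [mul_smul])
  smul_zero t := c.val_injective (by simp)
  smul_add t x y := c.val_injective (by simp)
  add_smul s t x := c.val_injective (by simp [add_smul])
  zero_smul x := c.val_injective (by simp)

theorem smul_val (s : S) (x : c.Comp M) : s • c.val x = c.val (c.proj s • x) := by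
  rw [val_smul, ← c.mul_incl_one, mul_smul, incl_one_smul_val]

/-- The projection of a module onto its component. -/
def part : M →+ c.Comp M :=
  AddMonoidHom.mk' (fun m => c.mkComp (c.incl 1 • m) (by rw [← mul_smul, incl_one_mul_incl]))
    fun m n => c.val_injective (by simp)

@[simp] theorem val_part (m : M) : c.val (c.part m) = c.incl 1 • m := rfl

@[simp] theorem part_val (x : c.Comp M) : c.part (c.val x) = x :=
  c.val_injective (c.incl_one_smul_val x)

theorem part_smul (s : S) (m : M) : c.part (s • m) = c.proj s • c.part m :=
  c.val_injective (by
    rw [← smul_val, val_part, val_part, ← mul_smul, ← mul_smul, incl_one_mul, mul_incl_one])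

variable {N P : Type u} [AddCommGroup N] [Module S N] [AddCommGroup P] [Module S P]

/-- Functoriality of the component. -/
def map (f : M →ₗ[S] N) : c.Comp M →ₗ[T] c.Comp N where
  toFun x := c.mkComp (f (c.val x)) (by rw [← map_smul, incl_one_smul_val])
  map_add' x y := c.val_injective (by simp)
  map_smul' t x := c.val_injective (by simp)

@[simp] theorem val_map (f : M →ₗ[S] N) (x : c.Comp M) : c.val (c.map f x) = f (c.val x) := rfl

theorem map_part (f : M →ₗ[S] N) (m : M) : c.map f (c.part m) = c.part (f m) :=
  c.val_injective (by simp)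

variable {f : M →ₗ[S] N} {g : N →ₗ[S] P}

theorem map_injective (hf : Function.Injective f) : Function.Injective (c.map f) :=
  fun _ _ h => c.val_injective (hf (congrArg c.val h))

theorem map_surjective (hf : Function.Surjective f) : Function.Surjective (c.map f) := fun y => by
  obtain ⟨m, hm⟩ := hf (c.val y)
  exact ⟨c.part m, by rw [map_part, hm, part_val]⟩

theorem map_exact (h : Function.Exact f g) : Function.Exact (c.map f) (c.map g) := fun y => by
  constructor
  · intro hy
    obtain ⟨m, hm⟩ := (h (c.val y)).1 (congrArg c.val hy)
    exact ⟨c.part m, by rw [map_part, hm, part_val]⟩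
  · rintro ⟨x, rfl⟩
    exact c.val_injective (by simp [h.apply_apply_eq_zero])

/-- Isomorphic modules have isomorphic components. -/
noncomputable def congr (e : M ≃ₗ[S] N) : c.Comp M ≃ₗ[T] c.Comp N :=
  LinearEquiv.ofBijective (c.map e.toLinearMap)
    ⟨c.map_injective e.injective, c.map_surjective e.surjective⟩

end Component

section Restriction

/-- A module over the factor `T`, viewed as an `S`-module. -/
def Res (_ : Corner S T) (N : Type u) : Type u := N

variable (N : Type u) [AddCommGroup N] [Module T N]

instance : AddCommGroup (c.Res N) := inferInstanceAs (AddCommGroup N)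

instance : Module S (c.Res N) := Module.compHom N c.proj

variable {N}

/-- The identity map from a `T`-module to its restriction. -/
def toRes : N ≃+ c.Res N := AddEquiv.refl N

theorem smul_toRes (s : S) (n : N) : s • c.toRes n = c.toRes (c.proj s • n) := rfl

@[simp] theorem incl_smul_toRes (t : T) (n : N) : c.incl t • c.toRes n = c.toRes (t • n) := by
  rw [smul_toRes, proj_incl]

theorem incl_one_smul_res (x : c.Res N) : c.incl 1 • x = x := by
  obtain ⟨n, rfl⟩ := c.toRes.surjective x
  rw [incl_smul_toRes, one_smul]

theorem toRes_symm_smul (s : S) (x : c.Res N) :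
    c.toRes.symm (s • x) = c.proj s • c.toRes.symm x := rfl

/-- The component of a restriction is the original module. -/
def compRes : c.Comp (c.Res N) ≃ₗ[T] N where
  toFun x := c.toRes.symm (c.val x)
  map_add' x y := by simp
  map_smul' t x := by
    rw [val_smul, toRes_symm_smul, proj_incl]; rfl
  invFun n := c.mkComp (c.toRes n) (by simp)
  left_inv x := c.val_injective (by simp)
  right_inv n := by simp

/-- Restriction of linear maps. -/
def resMap {N' : Type u} [AddCommGroup N'] [Module T N'] (f : N →ₗ[T] N') :
    c.Res N →ₗ[S] c.Res N' where
  toFun x := c.toRes (f (c.toRes.symm x))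
  map_add' x y := by simp
  map_smul' s x := by rw [toRes_symm_smul, map_smul]; rfl

theorem resMap_injective {N' : Type u} [AddCommGroup N'] [Module T N'] {f : N →ₗ[T] N'}
    (hf : Function.Injective f) : Function.Injective (c.resMap f) :=
  c.toRes.injective.comp (hf.comp c.toRes.symm.injective)

end Restriction

section Injective

theorem _root_.injective_of_linearEquiv {Q Q' : Type u} [AddCommGroup Q] [Module S Q]
    [AddCommGroup Q'] [Module S Q'] (e : Q ≃ₗ[S] Q') (h : Module.Injective S Q) :
    Module.Injective S Q' where
  out A B _ _ _ _ f hf g := by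
    obtain ⟨k, hk⟩ := h.out f hf (e.symm.toLinearMap.comp g)
    exact ⟨e.toLinearMap.comp k, fun a => by simp [hk]⟩

theorem injective_comp {M : Type u} [AddCommGroup M] [Module S M] (hM : Module.Injective S M) :
    Module.Injective T (c.Comp M) where
  out A B _ _ _ _ f hf g := by
    let g' : c.Res A →ₗ[S] M :=
      { toFun := fun a => c.val (g (c.toRes.symm a))
        map_add' := fun a b => by simp
        map_smul' := fun s a => by
          rw [toRes_symm_smul, map_smul, ← smul_val, RingHom.id_apply] }
    obtain ⟨h, hh⟩ := hM.out (c.resMap f) (c.resMap_injective hf) g'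
    refine ⟨⟨⟨fun b => c.part (h (c.toRes b)), fun a b => by simp⟩, fun t b => ?_⟩, fun a => ?_⟩
    · change c.part (h (c.toRes (t • b))) = t • c.part (h (c.toRes b))
      rw [← incl_smul_toRes, map_smul, part_smul, proj_incl]
    · exact (congrArg c.part (hh (c.toRes a))).trans (c.part_val _)

theorem injective_res {N : Type u} [AddCommGroup N] [Module T N] (hN : Module.Injective T N) :
    Module.Injective S (c.Res N) where
  out A B _ _ _ _ f hf g := by
    obtain ⟨h, hh⟩ := hN.out (c.map f) (c.map_injective hf)
      (c.compRes.toLinearMap.comp (c.map g))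
    refine ⟨⟨⟨fun b => c.toRes (h (c.part b)), fun a b => by simp⟩, fun s b => ?_⟩, fun a => ?_⟩
    · change c.toRes (h (c.part (s • b))) = s • c.toRes (h (c.part b))
      rw [part_smul, map_smul, smul_toRes]
    · change c.toRes (h (c.part (f a))) = g a
      rw [← map_part, hh, LinearMap.comp_apply, map_part]
      exact c.incl_one_smul_res (g a)

end Injective

section Character

variable {M : Type u} [AddCommGroup M] [Module S M]

/-- The component of the character module is the character module of the component. -/
def compCharDual : c.op.Comp (CharDual M) ≃ₗ[Tᵐᵒᵖ] CharDual (c.Comp M) where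
  toFun χ := CharDual.ofHom (AddMonoidHom.comp (c.op.val (M := CharDual M) χ) c.val)
  map_add' _ _ := rfl
  map_smul' _ _ := rfl
  invFun χ := c.op.mkComp (CharDual.ofHom (AddMonoidHom.comp χ c.part))
    (CharDual.ext fun m => congrArg χ (c.part_val (c.part m)))
  left_inv χ := c.op.val_injective (c.op.incl_one_smul_val χ)
  right_inv χ := CharDual.ext fun m => congrArg χ (c.part_val m)

theorem flat_comp (h : FlatDimLT S 1 M) : FlatDimLT T 1 (c.Comp M) := by
  rw [flatDimLT_one_iff, isFlatMod_iff_injective_charDual] at h ⊢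
  exact injective_of_linearEquiv c.compCharDual (c.op.injective_comp h)

theorem flat_res {N : Type u} [AddCommGroup N] [Module T N] (h : FlatDimLT T 1 N) :
    FlatDimLT S 1 (c.Res N) := by
  rw [flatDimLT_one_iff, isFlatMod_iff_injective_charDual] at h ⊢
  exact c.op.injective_res h

variable {A : Type u} [AddCommGroup A] [Module Sᵐᵒᵖ A]

/-- Restriction of a balanced pairing to components. -/
def restrictPairing (h : A →ₗ[Sᵐᵒᵖ] CharDual M) :
    c.op.Comp A →ₗ[Tᵐᵒᵖ] CharDual (c.Comp M) where
  toFun a := CharDual.ofHom (AddMonoidHom.comp (h (c.op.val a)) c.val)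
  map_add' a b := CharDual.ext fun m => by
    change h (c.op.val (a + b)) (c.val m) = _
    rw [map_add, map_add]; rfl
  map_smul' t a := CharDual.ext fun m => by
    change h (c.op.val (t • a)) (c.val m) = _
    rw [val_smul, map_smul]; rfl

theorem restrictPairing_apply (h : A →ₗ[Sᵐᵒᵖ] CharDual M) (a : c.op.Comp A) (m : c.Comp M) :
    c.restrictPairing h a m = h (c.op.val a) (c.val m) := rfl

/-- A balanced pairing of components, pulled back along the projections. -/
def inflatePairing (k : c.op.Comp A →ₗ[Tᵐᵒᵖ] CharDual (c.Comp M)) :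
    A →ₗ[Sᵐᵒᵖ] CharDual M where
  toFun a := CharDual.ofHom (AddMonoidHom.comp (k (c.op.part a)) c.part)
  map_add' a b := CharDual.ext fun m => by
    change k (c.op.part (a + b)) (c.part m) = _
    rw [map_add, map_add]; rfl
  map_smul' s a := CharDual.ext fun m => by
    change k (c.op.part (s • a)) (c.part m) = k (c.op.part a) (c.part (s.unop • m))
    rw [part_smul, part_smul, map_smul]; rfl

theorem inflatePairing_apply (k : c.op.Comp A →ₗ[Tᵐᵒᵖ] CharDual (c.Comp M)) (a : A) (m : M) :
    c.inflatePairing k a m = k (c.op.part a) (c.part m) := rfl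

theorem restrictPairing_part (h : A →ₗ[Sᵐᵒᵖ] CharDual M) (a : A) (m : M) :
    c.restrictPairing h (c.op.part a) (c.part m) = h a (c.incl 1 • m) := by
  rw [restrictPairing_apply, val_part, val_part, h.map_smul, CharDual.smul_apply]
  change h a (c.incl 1 • c.incl 1 • m) = _
  rw [← mul_smul, incl_one_mul_incl]

end Character

end Corner


/-! ### Gorenstein flat modules over a product of an IF ring and a ring of finite dimension -/

theorem Corner.isLeftIF {S T : Type u} [Ring S] [Ring T] (c : Corner S T) (h : IsLeftIF S) :
    IsLeftIF T := fun E hE => by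
  have hinj : Module.Injective S (c.Res E) := c.injective_res hE
  have hflat : FlatDimLT S 1 (c.Res E) := flatDimLT_one_iff.2 (h _ hinj)
  exact flatDimLT_one_iff.1 ((c.flat_comp hflat).of_equiv c.compRes)

theorem exists_extension_of_flat_right {S : Type u} [Ring S] {A K F : Type u} [AddCommGroup A]
    [Module Sᵐᵒᵖ A] [AddCommGroup K] [Module S K] [AddCommGroup F] [Module S F]
    (hA : FlatDimLT Sᵐᵒᵖ 1 A) {f : K →ₗ[S] F} (hf : Function.Injective f)
    (k : A →ₗ[Sᵐᵒᵖ] CharDual K) :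
    ∃ l : A →ₗ[Sᵐᵒᵖ] CharDual F, ∀ a m, l a (f m) = k a m := by
  rw [flatDimLT_one_iff, isFlatMod_iff_injective_charDual] at hA
  let c : Corner Sᵐᵒᵖᵐᵒᵖ S := .ofRingEquiv (RingEquiv.opOp S).symm
  let k' : c.Res K →ₗ[Sᵐᵒᵖᵐᵒᵖ] CharDual A :=
    { toFun := fun x => CharDual.ofHom (AddMonoidHom.mk' (fun a => k a (c.toRes.symm x))
        fun a b => by rw [map_add, CharDual.add_apply])
      map_add' := fun x y => CharDual.ext fun a => map_add (k a) _ _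
      map_smul' := fun s x => CharDual.ext fun a =>
        (congrArg (fun χ : CharDual K => χ (c.toRes.symm x)) (map_smul k s.unop a)).symm }
  obtain ⟨l, hl⟩ := hA.out (c.resMap f) (c.resMap_injective hf) k'
  refine ⟨⟨⟨fun a => CharDual.ofHom (AddMonoidHom.mk' (fun m => l (c.toRes m) a)
    fun m n => by rw [map_add, map_add, CharDual.add_apply]),
    fun a b => CharDual.ext fun m => map_add (l (c.toRes m)) a b⟩,
    fun s a => CharDual.ext fun m => ?_⟩, fun a m => ?_⟩
  · exact (congrArg (fun χ : CharDual A => χ a) (map_smul l (op s) (c.toRes m))).symm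
  · exact congrArg (fun χ : CharDual A => χ a) (hl (c.toRes m))

section Pair

variable {S R₁ R₂ : Type u} [Ring S] [Ring R₁] [Ring R₂] (c₁ : Corner S R₁) (c₂ : Corner S R₂)
variable {K F M : Type u} [AddCommGroup K] [Module S K] [AddCommGroup F] [Module S F]
  [AddCommGroup M] [Module S M] {f : K →ₗ[S] F} {g : F →ₗ[S] M}

theorem rmap_injective_of_flat_comp (hc : c₁.incl 1 + c₂.incl 1 = 1) (h₁ : IsLeftIF R₁ᵐᵒᵖ)
    (hf : Function.Injective f) (hg : Function.Surjective g) (h : Function.Exact f g)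
    (hM : FlatDimLT R₂ 1 (c₂.Comp M)) (A : Type u) [AddCommGroup A] [Module Sᵐᵒᵖ A]
    (hA : Module.Injective Sᵐᵒᵖ A) : Function.Injective (NTensor.rmap A f) := by
  refine NTensor.rmap_injective f fun k => ?_
  obtain ⟨l₁, hl₁⟩ := exists_extension_of_flat_right
    (flatDimLT_one_iff.2 (h₁ (.of _ (c₁.op.Comp A)) (c₁.op.injective_comp hA)))
    (c₁.map_injective hf) (c₁.restrictPairing k)
  obtain ⟨l₂, hl₂⟩ := exists_extension_of_flat (c₂.map_injective hf) (c₂.map_surjective hg)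
    (c₂.map_exact h) hM (c₂.restrictPairing k)
  refine ⟨c₁.inflatePairing l₁ + c₂.inflatePairing l₂, fun a m => ?_⟩
  rw [LinearMap.add_apply, CharDual.add_apply, Corner.inflatePairing_apply,
    Corner.inflatePairing_apply, ← c₁.map_part, ← c₂.map_part, hl₁, hl₂,
    Corner.restrictPairing_part, Corner.restrictPairing_part, ← map_add, ← add_smul, hc, one_smul]

end Pair

/-! ### Splicing short exact sequences into complete flat resolutions -/

theorem exists_int_chain {α : Type*} {r : α → α → Prop} (hl : ∀ y, ∃ x, r x y)
    (hr : ∀ x, ∃ y, r x y) (a : α) : ∃ z : ℤ → α, z 1 = a ∧ ∀ n, r (z n) (z (n + 1)) := by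
  choose p hp using hl
  choose s hs using hr
  let w : ℤ → α := fun n => Int.casesOn n (fun k => s^[k] a) (fun k => p^[k + 1] a)
  have hw : ∀ n, r (w n) (w (n + 1)) := by
    rintro (k | _ | k)
    · change r (s^[k] a) (s^[k + 1] a)
      rw [Function.iterate_succ_apply']
      exact hs _
    · exact hp a
    · change r (p^[k + 2] a) (p^[k + 1] a)
      rw [Function.iterate_succ_apply' p (k + 1)]
      exact hp _
  refine ⟨fun n => w (n - 1), rfl, fun n => ?_⟩
  have := hw (n - 1)
  rwa [show n - 1 + 1 = n + 1 - 1 by ring] at this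

theorem Function.Exact.comp_surjective_injective {A B C D E : Type*} [Zero D] [Zero E]
    {p : A → B} {i : B → C} {q : C → D} {j : D → E} (hp : Function.Surjective p)
    (h : Function.Exact i q) (hj : Function.Injective j) (hj0 : j 0 = 0) :
    Function.Exact (i ∘ p) (j ∘ q) := fun x => by
  rw [hp.range_comp, ← h x, Function.comp_apply, ← hj0, hj.eq_iff]

section Splice

variable {S : Type u} [Ring S]

/-- `Y` is the cokernel of an embedding of `X` into a flat module that stays injective after
tensoring with injective right modules. -/
def FlatStep (X Y : ModuleCat.{u} S) : Prop :=
  ∃ (F : ModuleCat.{u} S) (ι : X →ₗ[S] F) (π : F →ₗ[S] Y), IsFlatMod S F ∧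
    Function.Injective ι ∧ Function.Surjective π ∧ Function.Exact ι π ∧
    ∀ (I : Type u) [AddCommGroup I] [Module Sᵐᵒᵖ I], Module.Injective Sᵐᵒᵖ I →
      Function.Injective (NTensor.rmap I ι)

theorem isGorensteinFlat_of_flatStep {P : ModuleCat.{u} S → Prop}
    (hl : ∀ Y, P Y → ∃ X, P X ∧ FlatStep X Y) (hr : ∀ X, P X → ∃ Y, P Y ∧ FlatStep X Y)
    {M : ModuleCat.{u} S} (hM : P M) : IsGorensteinFlat S M := by
  obtain ⟨Z, hZ, h⟩ := exists_int_chain (α := {X // P X}) (r := fun X Y => FlatStep X.1 Y.1)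
    (fun Y => let ⟨X, hX, h⟩ := hl Y.1 Y.2; ⟨⟨X, hX⟩, h⟩)
    (fun X => let ⟨Y, hY, h⟩ := hr X.1 X.2; ⟨⟨Y, hY⟩, h⟩) ⟨M, hM⟩
  choose F ι π hF hι hπ hιπ hT using h
  refine ⟨F, fun n => (ι (n + 1)).comp (π n), hF, fun n => ?_, ?_, fun I _ _ hI n => ?_⟩
  · rw [LinearMap.coe_comp, LinearMap.coe_comp]
    exact (hιπ (n + 1)).comp_surjective_injective (hπ n) (hι (n + 1 + 1)) (map_zero _)
  · have hM : M = (Z (0 + 1)).1 := (congrArg Subtype.val hZ).symm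
    rw [LinearMap.range_comp_of_range_eq_top _ (LinearMap.range_eq_top.2 (hπ 0)), hM]
    exact ⟨LinearEquiv.ofInjective _ (hι (0 + 1))⟩
  · rw [NTensor.rmap_comp, NTensor.rmap_comp, AddMonoidHom.coe_comp, AddMonoidHom.coe_comp]
    exact (NTensor.rmap_exact (hπ _) (hιπ (n + 1))).comp_surjective_injective
      (NTensor.rmap_surjective (hπ n)) (hT (n + 1 + 1) I hI) (map_zero _)

theorem exists_injective_embedding (M : Type u) [AddCommGroup M] [Module S M] :
    ∃ (E : ModuleCat.{u} S) (j : M →ₗ[S] E), Module.Injective S E ∧ Function.Injective j := by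
  obtain ⟨E, hE, j, hj⟩ := CategoryTheory.EnoughInjectives.presentation (ModuleCat.of S M)
  exact ⟨E, j.hom, Module.injective_module_of_injective_object S E,
    (ModuleCat.mono_iff_injective j).1 hj⟩

end Splice

section Pair

variable {S R₁ R₂ : Type u} [Ring S] [Ring R₁] [Ring R₂] (c₁ : Corner S R₁) (c₂ : Corner S R₂)

theorem exists_free_cover (M : Type u) [AddCommGroup M] [Module S M] :
    ∃ (K F : ModuleCat.{u} S) (ι : K →ₗ[S] F) (π : F →ₗ[S] M), FlatDimLT S 1 F ∧
      Function.Injective ι ∧ Function.Surjective π ∧ Function.Exact ι π :=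
  ⟨.of S (LinearMap.ker (Finsupp.linearCombination S (id : M → M))), .of S (M →₀ S),
    Submodule.subtype _, Finsupp.linearCombination S id, flatDimLT_one_finsupp M,
    Subtype.val_injective, fun m => ⟨Finsupp.single m 1, by simp⟩,
    LinearMap.exact_subtype_ker_map _⟩

theorem exists_flatStep_left (hc : c₁.incl 1 + c₂.incl 1 = 1) (h₁ : IsLeftIF R₁ᵐᵒᵖ)
    (Y : ModuleCat.{u} S) (hY : FlatDimLT R₂ 1 (c₂.Comp Y)) :
    ∃ X : ModuleCat.{u} S, FlatDimLT R₂ 1 (c₂.Comp X) ∧ FlatStep X Y := by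
  obtain ⟨K, F, ι, π, hF, hι, hπ, hιπ⟩ := exists_free_cover (S := S) Y
  exact ⟨K, (c₂.flat_comp hF).kernel (c₂.map_injective hι) (c₂.map_surjective hπ)
    (c₂.map_exact hιπ) (hY.mono one_le_two), F, ι, π, flatDimLT_one_iff.1 hF, hι, hπ, hιπ,
    rmap_injective_of_flat_comp c₁ c₂ hc h₁ hι hπ hιπ hY⟩

/-- A module embeds into the restriction of an extension of its first component, times its second
component. -/
def prodEmbedding {M E : Type u} [AddCommGroup M] [Module S M] [AddCommGroup E] [Module R₁ E]
    (j : c₁.Comp M →ₗ[R₁] E) : M →ₗ[S] c₁.Res E × c₂.Res (c₂.Comp M) where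
  toFun m := (c₁.toRes (j (c₁.part m)), c₂.toRes (c₂.part m))
  map_add' m n := by simp
  map_smul' s m := by
    ext
    · simp [Corner.part_smul, Corner.smul_toRes]
    · simp [Corner.part_smul, Corner.smul_toRes]

theorem exists_flatStep_right (hc : c₁.incl 1 + c₂.incl 1 = 1) (h₁l : IsLeftIF R₁)
    (h₁ : IsLeftIF R₁ᵐᵒᵖ) (X : ModuleCat.{u} S) (hX : FlatDimLT R₂ 1 (c₂.Comp X)) :
    ∃ Y : ModuleCat.{u} S, FlatDimLT R₂ 1 (c₂.Comp Y) ∧ FlatStep X Y := by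
  obtain ⟨E, j, hE, hj⟩ := exists_injective_embedding (S := R₁) (c₁.Comp X)
  let ι := prodEmbedding c₁ c₂ j
  have hι : Function.Injective ι := by
    rw [injective_iff_map_eq_zero]
    intro m hm
    have hm₁ : c₁.part m = 0 := hj ((congrArg Prod.fst hm).trans (map_zero j).symm)
    have hm₂ : c₂.part m = 0 := congrArg Prod.snd hm
    rw [← one_smul S m, ← hc, add_smul, ← c₁.val_part, ← c₂.val_part, hm₁, hm₂, map_zero,
      map_zero, add_zero]
  have horth : c₂.incl 1 * c₁.incl 1 = 0 := by
    have := congrArg (c₂.incl 1 * ·) hc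
    simpa [mul_add, c₂.incl_one_mul_incl] using this
  have hY : Subsingleton (c₂.Comp (_ ⧸ LinearMap.range ι)) := by
    refine subsingleton_of_forall_eq 0 fun y => c₂.val_injective ?_
    obtain ⟨⟨x₁, x₂⟩, hx⟩ := Submodule.mkQ_surjective _ (c₂.val y)
    rw [← c₂.incl_one_smul_val, ← hx, ← map_smul, map_zero, Submodule.mkQ_apply,
      Submodule.Quotient.mk_eq_zero]
    obtain ⟨z, rfl⟩ := c₂.toRes.surjective x₂
    refine ⟨c₂.val z, Prod.ext ?_ ?_⟩
    · change c₁.toRes (j (c₁.part (c₂.val z))) = c₂.incl 1 • x₁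
      rw [← c₂.incl_one_smul_val, Corner.part_smul, map_smul, ← c₁.smul_toRes,
        ← c₁.incl_one_smul_res (c₁.toRes _), ← c₁.incl_one_smul_res x₁, ← mul_smul, ← mul_smul,
        horth, zero_smul, zero_smul]
    · change c₂.toRes (c₂.part (c₂.val z)) = c₂.incl 1 • c₂.toRes z
      rw [c₂.part_val, c₂.incl_one_smul_res]
  have hflat : FlatDimLT R₂ 1 (c₂.Comp (_ ⧸ LinearMap.range ι)) := flatDimLT_one_of_subsingleton
  have hπ := Submodule.mkQ_surjective (LinearMap.range ι)
  have hιπ := LinearMap.exact_map_mkQ_range ι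
  exact ⟨.of S (_ ⧸ LinearMap.range ι), hflat, .of S (c₁.Res E × c₂.Res (c₂.Comp X)), ι,
    Submodule.mkQ _, flatDimLT_one_iff.1 (flatDimLT_one_prod
      (c₁.flat_res (flatDimLT_one_iff.2 (h₁l E hE))) (c₂.flat_res hX)), hι, hπ, hιπ,
    rmap_injective_of_flat_comp c₁ c₂ hc h₁ hι hπ hιπ hflat⟩

theorem isGorensteinFlat_of_flat_comp (hc : c₁.incl 1 + c₂.incl 1 = 1) (h₁l : IsLeftIF R₁)
    (h₁ : IsLeftIF R₁ᵐᵒᵖ) {M : ModuleCat.{u} S} (hM : FlatDimLT R₂ 1 (c₂.Comp M)) :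
    IsGorensteinFlat S M :=
  isGorensteinFlat_of_flatStep (P := fun X => FlatDimLT R₂ 1 (c₂.Comp X))
    (exists_flatStep_left c₁ c₂ hc h₁) (exists_flatStep_right c₁ c₂ hc h₁l h₁) hM

theorem flat_comp_of_isGorensteinFlat {N : ℕ}
    (h₂ : ∀ X : ModuleCat.{u} R₂, FlatDimLT R₂ (N + 1) X) {M : ModuleCat.{u} S}
    (hM : IsGorensteinFlat S M) : FlatDimLT R₂ 1 (c₂.Comp M) := by
  obtain ⟨F, d, hF, hd, ⟨e⟩, -⟩ := hM
  have key : ∀ n k, FlatDimLT R₂ (N - n + 1) (c₂.Comp (LinearMap.range (d k))) := by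
    intro n
    induction n with
    | zero => exact fun k => h₂ (.of R₂ (c₂.Comp (LinearMap.range (d k))))
    | succ n ih =>
      intro k
      have hsub := Submodule.subtype_injective (LinearMap.range (d k))
      have hres := (d (k + 1)).surjective_rangeRestrict
      have hex : Function.Exact (LinearMap.range (d k)).subtype (d (k + 1)).rangeRestrict := by
        intro x
        rw [← Subtype.coe_inj, Submodule.coe_subtype, Subtype.range_coe]
        exact hd k x
      refine FlatDimLT.kernel (c₂.map_injective hsub) (c₂.map_surjective hres) (c₂.map_exact hex)
        ((c₂.flat_comp (flatDimLT_one_iff.2 (hF (k + 1)))).mono (by omega))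
        ((ih (k + 1)).mono (by omega))
  have := key N 0
  rw [Nat.sub_self] at this
  exact this.of_equiv (c₂.congr e.symm)

theorem isGFClosed_of_pair (hc : c₁.incl 1 + c₂.incl 1 = 1) (h₁l : IsLeftIF R₁)
    (h₁ : IsLeftIF R₁ᵐᵒᵖ) {N : ℕ} (h₂ : ∀ X : ModuleCat.{u} R₂, FlatDimLT R₂ (N + 1) X) :
    IsGFClosed S := fun _ _ _ _ _ hf hg h hA hC =>
  isGorensteinFlat_of_flat_comp c₁ c₂ hc h₁l h₁ (FlatDimLT.middle (c₂.map_injective hf)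
    (c₂.map_surjective hg) (c₂.map_exact h) (flat_comp_of_isGorensteinFlat c₂ h₂ hA)
    (flat_comp_of_isGorensteinFlat c₂ h₂ hC))

theorem gflatDimLE_of_flatDimLT_comp (hc : c₁.incl 1 + c₂.incl 1 = 1) (h₁l : IsLeftIF R₁)
    (h₁ : IsLeftIF R₁ᵐᵒᵖ) (n : ℕ) (M : ModuleCat.{u} S)
    (hM : FlatDimLT R₂ (n + 1) (c₂.Comp M)) : gflatDimLE S n M := by
  induction n generalizing M with
  | zero => exact isGorensteinFlat_of_flat_comp c₁ c₂ hc h₁l h₁ hM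
  | succ n ih =>
    obtain ⟨K, F, ι, π, hF, hι, hπ, hιπ⟩ := exists_free_cover (S := S) M
    exact ⟨K, F, ι, π, hι, hπ, hιπ,
      isGorensteinFlat_of_flat_comp c₁ c₂ hc h₁l h₁ (c₂.flat_comp hF),
      ih K (((c₂.flat_comp hF).mono (by omega)).kernel (c₂.map_injective hι)
        (c₂.map_surjective hπ) (c₂.map_exact hιπ) hM)⟩

theorem gorensteinWeakGlobalDim_ne_top_of_pair (hc : c₁.incl 1 + c₂.incl 1 = 1)
    (h₁l : IsLeftIF R₁) (h₁ : IsLeftIF R₁ᵐᵒᵖ) {N : ℕ}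
    (h₂ : ∀ X : ModuleCat.{u} R₂, FlatDimLT R₂ (N + 1) X) : gorensteinWeakGlobalDim S ≠ ⊤ :=
  ne_top_of_le_ne_top (ENat.natCast_ne_top N) (iSup_le fun M => sInf_le
    ⟨N, rfl, gflatDimLE_of_flatDimLT_comp c₁ c₂ hc h₁l h₁ N M (h₂ (.of R₂ (c₂.Comp M)))⟩)

end Pair

/-! ### Weak global dimension and coherence of factors -/

section Factor

variable {S T : Type u} [Ring S] [Ring T]

theorem FlatDimLT.flatDimLE {n : ℕ} {M : ModuleCat.{u} S} (h : FlatDimLT S (n + 1) M) :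
    flatDimLE S n M := by
  induction n generalizing M with
  | zero => exact flatDimLT_one_iff.1 h
  | succ n ih =>
    obtain ⟨K, F, ι, π, hF, hι, hπ, hιπ⟩ := exists_free_cover (S := S) M
    exact ⟨K, F, ι, π, hι, hπ, hιπ, flatDimLT_one_iff.1 hF,
      ih ((hF.mono (by omega)).kernel hι hπ hιπ h)⟩

theorem weakGlobalDim_ne_top_iff :
    weakGlobalDim S ≠ ⊤ ↔ ∃ N : ℕ, ∀ M : ModuleCat.{u} S, FlatDimLT S (N + 1) M := by
  constructor
  · intro h
    obtain ⟨N, hN⟩ := ENat.ne_top_iff_exists.1 h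
    refine ⟨N, fun M => ?_⟩
    have hM : flatDim S M < (N + 1 : ℕ) :=
      ((le_iSup (flatDim S) M).trans_eq hN.symm).trans_lt (Nat.cast_lt.2 N.lt_succ_self)
    obtain ⟨_, ⟨n, rfl, hn⟩, hlt⟩ := sInf_lt_iff.1 hM
    exact (FlatDimLT.of_flatDimLE hn).mono (Nat.succ_le_of_lt (Nat.cast_lt.1 hlt))
  · rintro ⟨N, hN⟩
    exact ne_top_of_le_ne_top (ENat.natCast_ne_top N)
      (iSup_le fun M => sInf_le ⟨N, rfl, (hN M).flatDimLE⟩)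

namespace Corner

variable (c : Corner S T)

theorem flatDimLT_comp {n : ℕ} {M : ModuleCat.{u} S} (h : FlatDimLT S (n + 1) M) :
    FlatDimLT T (n + 1) (c.Comp M) := by
  induction n generalizing M with
  | zero => exact c.flat_comp h
  | succ n ih =>
    obtain ⟨K, F, ι, π, hF, hι, hπ, hιπ⟩ := exists_free_cover (S := S) M
    exact (ih ((hF.mono (by omega)).kernel hι hπ hιπ h)).cokernel (c.map_injective hι)
      (c.map_surjective hπ) (c.map_exact hιπ) ((c.flat_comp hF).mono (by omega))

theorem weakGlobalDim_eq_top (c : Corner S T) (h : weakGlobalDim T = ⊤) : weakGlobalDim S = ⊤ := by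
  contrapose! h
  obtain ⟨N, hN⟩ := weakGlobalDim_ne_top_iff.1 h
  exact weakGlobalDim_ne_top_iff.2 ⟨N, fun M =>
    (c.flatDimLT_comp (hN (.of S (c.Res M)))).of_equiv c.compRes⟩

theorem finite_res (N : Type u) [AddCommGroup N] [Module T N] [Module.Finite T N] :
    Module.Finite S (c.Res N) := by
  obtain ⟨s, hs⟩ := Module.Finite.fg_top (R := T) (M := N)
  classical
  refine ⟨⟨s.image c.toRes, eq_top_iff.2 fun x _ => ?_⟩⟩
  obtain ⟨n, rfl⟩ := c.toRes.surjective x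
  have hn : n ∈ Submodule.span T (s : Set N) := hs ▸ Submodule.mem_top
  induction hn using Submodule.span_induction with
  | mem y hy => exact Submodule.subset_span (by simpa using hy)
  | zero => simp
  | add y z _ _ hy hz => exact map_add c.toRes y z ▸ add_mem (hy trivial) (hz trivial)
  | smul t y _ hy => exact c.incl_smul_toRes t y ▸ Submodule.smul_mem _ _ (hy trivial)

/-- A left ideal of the factor, embedded in the ring. -/
def idealEmbedding (I : Submodule T T) : c.Res I →ₗ[S] S where
  toFun x := c.incl (c.toRes.symm x : I)
  map_add' x y := by simp
  map_smul' s x := by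
    rw [toRes_symm_smul, Submodule.coe_smul, smul_eq_mul, map_mul, ← c.mul_incl_one, mul_assoc,
      incl_one_mul_incl, RingHom.id_apply, smul_eq_mul]

theorem idealEmbedding_injective (I : Submodule T T) : Function.Injective (c.idealEmbedding I) :=
  fun _ _ h => c.toRes.symm.injective (Subtype.ext
    ((c.proj_incl _).symm.trans ((congrArg c.proj h).trans (c.proj_incl _))))

theorem isLeftCoherent (c : Corner S T) (h : IsLeftCoherent S) : IsLeftCoherent T := by
  intro I hI
  have : Module.Finite T I := .of_fg hI
  have := c.finite_res I
  have : Module.FinitePresentation S (LinearMap.range (c.idealEmbedding I)) :=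
    h _ (Module.Finite.iff_fg.1 inferInstance)
  have : Module.FinitePresentation S (c.Res I) := .of_equiv
    (LinearEquiv.ofInjective _ (c.idealEmbedding_injective I)).symm
  obtain ⟨n, π, hπ⟩ := Module.Finite.exists_fin' T I
  have hπ' : Function.Surjective (c.resMap π) :=
    c.toRes.surjective.comp (hπ.comp c.toRes.symm.surjective)
  have := c.finite_res (Fin n → T)
  have : Module.Finite S (LinearMap.ker (c.resMap π)) :=
    .of_fg (Module.FinitePresentation.fg_ker _ hπ')
  have : RingHomSurjective c.proj := ⟨fun t => ⟨c.incl t, c.proj_incl t⟩⟩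
  let k : LinearMap.ker (c.resMap π) →ₛₗ[c.proj] LinearMap.ker π :=
    { toFun := fun x => ⟨c.toRes.symm x.1, x.2⟩
      map_add' := fun x y => rfl
      map_smul' := fun s x => rfl }
  have : Module.Finite T (LinearMap.ker π) :=
    .of_surjective k fun y => ⟨⟨c.toRes y.1, y.2⟩, rfl⟩
  exact Module.finitePresentation_of_free_of_surjective π hπ (Module.Finite.iff_fg.1 this)

end Corner

end Factor

/-- **Example 2.12.**  If `R₁` is an IF ring with infinite weak global dimension and `R₂` is a
non-coherent ring with finite weak global dimension, then `R₁ × R₂` is a GF-closed ring with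
finite left and right weak Gorenstein global dimensions which is neither coherent nor of
finite weak global dimension. -/
theorem product_gfClosed_finite_gwdim_not_coherent (R₁ R₂ : Type u) [Ring R₁] [Ring R₂]
    (h1l : IsLeftIF R₁) (h1r : IsLeftIF R₁ᵐᵒᵖ)
    (h2l : weakGlobalDim R₁ = ⊤) (h2r : weakGlobalDim R₁ᵐᵒᵖ = ⊤)
    (h3 : ¬ (IsLeftCoherent R₂ ∧ IsLeftCoherent R₂ᵐᵒᵖ))
    (h4l : weakGlobalDim R₂ ≠ ⊤) (h4r : weakGlobalDim R₂ᵐᵒᵖ ≠ ⊤) :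
    (IsGFClosed (R₁ × R₂) ∧ IsGFClosed (R₁ × R₂)ᵐᵒᵖ) ∧
    (gorensteinWeakGlobalDim (R₁ × R₂) ≠ ⊤ ∧ gorensteinWeakGlobalDim (R₁ × R₂)ᵐᵒᵖ ≠ ⊤) ∧
    ¬ (IsLeftCoherent (R₁ × R₂) ∧ IsLeftCoherent (R₁ × R₂)ᵐᵒᵖ) ∧
    (weakGlobalDim (R₁ × R₂) = ⊤ ∧ weakGlobalDim (R₁ × R₂)ᵐᵒᵖ = ⊤) := by
  let c₁ := Corner.fst R₁ R₂
  let c₂ := Corner.snd R₁ R₂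
  have hc : c₁.incl 1 + c₂.incl 1 = 1 :=
    show ((1 : R₁), (0 : R₂)) + ((0 : R₁), (1 : R₂)) = 1 by simp
  have hc' : c₁.op.incl 1 + c₂.op.incl 1 = 1 := congrArg op hc
  have h1 : IsLeftIF R₁ᵐᵒᵖᵐᵒᵖ := (Corner.ofRingEquiv (RingEquiv.opOp R₁)).isLeftIF h1l
  obtain ⟨N, hN⟩ := weakGlobalDim_ne_top_iff.1 h4l
  obtain ⟨N', hN'⟩ := weakGlobalDim_ne_top_iff.1 h4r
  exact ⟨⟨isGFClosed_of_pair c₁ c₂ hc h1l h1r hN, isGFClosed_of_pair c₁.op c₂.op hc' h1r h1 hN'⟩,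
    ⟨gorensteinWeakGlobalDim_ne_top_of_pair c₁ c₂ hc h1l h1r hN,
      gorensteinWeakGlobalDim_ne_top_of_pair c₁.op c₂.op hc' h1r h1 hN'⟩,
    fun h => h3 ⟨c₂.isLeftCoherent h.1, c₂.op.isLeftCoherent h.2⟩,
    c₁.weakGlobalDim_eq_top h2l, c₁.op.weakGlobalDim_eq_top h2r⟩
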